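/- arXiv:1304.2096 — 2 statements merged into one kernel-verified Lean document; each statement's English description precedes it below -/
import Mathlib

section
/- Let $E$ be an infinite-dimensional normed space and suppose $2 \le p \le q < \infty$. Then for every $n \in \mathbb{N}$, the $(q,p)$-summing constant satisfies $\pi^{(n)}_{q,p}(E) = n^{1/q}$. -/
open scoped BigOperators

/-- The weak `p`-summing norm of a tuple in a complex normed space. -/
noncomputable def weakSummingNorm {E : Type*} [NormedAddCommGroup E] [NormedSpace ℂ E]
    (p : ℝ) {n : ℕ} (x : Fin n → E) : ℝ :=
  sSup {s : ℝ | ∃ lam : E →L[ℂ] ℂ, ‖lam‖ ≤ 1 ∧ s = (∑ i, ‖lam (x i)‖ ^ p) ^ (1 / p)}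

/-- The `(q,p)`-summing constant `π^{(n)}_{q,p}(E)` of a normed space `E`. -/
noncomputable def summingConstant (E : Type*) [NormedAddCommGroup E] [NormedSpace ℂ E]
    (q p : ℝ) (n : ℕ) : ℝ :=
  sSup {s : ℝ | ∃ x : Fin n → E, weakSummingNorm p x ≤ 1 ∧ s = (∑ i, ‖x i‖ ^ q) ^ (1 / q)}

open Module

/-- The determinant of `1 + t P` for a projection `P` onto `K`. -/
lemma LinearMap.IsProj.det_one_add_smul {V : Type*} [AddCommGroup V] [Module ℂ V]
    [FiniteDimensional ℂ V] {K : Submodule ℂ V} {P : V →ₗ[ℂ] V} (hP : LinearMap.IsProj K P)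
    (t : ℂ) : LinearMap.det (LinearMap.id + t • P) = (1 + t) ^ finrank ℂ K := by
  have key : LinearMap.id + t • P = (K.prodEquivOfIsCompl P.ker hP.isCompl).conj
      (LinearMap.prodMap ((1 + t) • LinearMap.id) LinearMap.id) := by
    have h : LinearMap.prodMap ((1 + t) • LinearMap.id) LinearMap.id
        = (LinearMap.id : (K × P.ker) →ₗ[ℂ] (K × P.ker))
          + t • LinearMap.prodMap LinearMap.id 0 := by
      ext x <;> simp [add_smul]
    rw [h, map_add, map_smul, ← hP.eq_conj_prodMap, LinearEquiv.conj_id]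
  rw [key, LinearEquiv.conj_apply, LinearMap.comp_assoc, LinearMap.det_conj,
    LinearMap.det_prodMap, LinearMap.det_smul]
  simp

/-- If `(1 + t) ^ m ≤ (1 + t c) ^ N` for all `t ≥ 0`, comparing slopes at `0` gives `m ≤ N c`. -/
lemma natCast_le_mul_of_forall_one_add_pow_le {m N : ℕ} {c : ℝ} (hc : 0 ≤ c)
    (h : ∀ t : ℝ, 0 ≤ t → (1 + t) ^ m ≤ (1 + t * c) ^ N) : (m : ℝ) ≤ N * c := by
  by_contra! hlt
  set a : ℝ := N * c with ha
  have ha0 : 0 ≤ a := by positivity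
  have hd : 0 < (m : ℝ) * a + 1 := by positivity
  set t : ℝ := (m - a) / (m * a + 1) with ht
  have ht0 : 0 < t := div_pos (by linarith) hd
  have hta : t * (m * a + 1) = m - a := div_mul_cancel₀ _ hd.ne'
  have h1 : 1 + m * t ≤ Real.exp (t * a) := calc
    1 + m * t ≤ (1 + t) ^ m := one_add_mul_le_pow (by linarith) m
    _ ≤ (1 + t * c) ^ N := h t ht0.le
    _ ≤ Real.exp (t * c) ^ N := by
      gcongr
      linarith [Real.add_one_le_exp (t * c)]
    _ = Real.exp (t * a) := by
      rw [← Real.exp_nat_mul, ha]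
      congr 1
      ring
  have h2 : 1 - t * a ≤ Real.exp (-(t * a)) := by linarith [Real.add_one_le_exp (-(t * a))]
  have h3 : (1 + m * t) * (1 - t * a) ≤ 1 := calc
    (1 + m * t) * (1 - t * a) ≤ (1 + m * t) * Real.exp (-(t * a)) := by gcongr
    _ ≤ Real.exp (t * a) * Real.exp (-(t * a)) := by gcongr
    _ = 1 := by rw [← Real.exp_add]; simp
  nlinarith [mul_pos ht0 ht0]

section DvoretzkyRogers

variable {H F : Type*} [NormedAddCommGroup H] [InnerProductSpace ℂ H] [FiniteDimensional ℂ H]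
  [NormedAddCommGroup F] [NormedSpace ℂ F]

/-- A contraction of maximal determinant cannot be small on a large subspace. -/
lemma exists_contraction_forall_finrank_le [FiniteDimensional ℂ F]
    (hHF : finrank ℂ H = finrank ℂ F) :
    ∃ T : H →L[ℂ] F, ‖T‖ ≤ 1 ∧ ∀ (K : Submodule ℂ H) (c : ℝ), 0 ≤ c →
      (∀ u ∈ K, ‖T u‖ ≤ c * ‖u‖) → (finrank ℂ K : ℝ) ≤ finrank ℂ H * c := by
  let φ : F ≃L[ℂ] H := ContinuousLinearEquiv.ofFinrankEq hHF.symm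
  let d : (H →L[ℂ] F) → ℝ := fun T => ‖((φ : F →L[ℂ] H).comp T).det‖
  have hd : Continuous d :=
    (ContinuousLinearMap.continuous_det.comp
      (continuous_const.clm_comp continuous_id)).norm
  have hsmul : ∀ (a : ℂ) (T : H →L[ℂ] F), d (a • T) = ‖a‖ ^ finrank ℂ H * d T := by
    intro a T
    simp only [d, ContinuousLinearMap.comp_smul, ContinuousLinearMap.det,
      ContinuousLinearMap.toLinearMap_smul, LinearMap.det_smul, norm_mul, norm_pow]
  have : ProperSpace (H →L[ℂ] F) := FiniteDimensional.proper ℂ _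
  obtain ⟨T, hT, hmax⟩ := (isCompact_closedBall (0 : H →L[ℂ] F) 1).exists_isMaxOn
    ⟨0, by simp⟩ hd.continuousOn
  have hT1 : ‖T‖ ≤ 1 := by simpa using hT
  have hle : ∀ S : H →L[ℂ] F, ∀ r : ℝ, 0 < r → ‖S‖ ≤ r → d S ≤ r ^ finrank ℂ H * d T := by
    intro S r hr hS
    have hmem : ((r⁻¹ : ℝ) : ℂ) • S ∈ Metric.closedBall (0 : H →L[ℂ] F) 1 := by
      rw [mem_closedBall_zero_iff, norm_smul, Complex.norm_real, Real.norm_of_nonneg (by positivity),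
        inv_mul_le_one₀ hr]
      exact hS
    have h := hmax hmem
    simp only [Set.mem_ofPred_eq, hsmul, Complex.norm_real, Real.norm_of_nonneg (inv_pos.2 hr).le,
      inv_pow] at h
    rwa [inv_mul_le_iff₀ (by positivity)] at h
  have hpos : 0 < d T := by
    have h1 : d (φ.symm : H →L[ℂ] F) = 1 := by
      simp [d, ContinuousLinearMap.det]
    have h2 := hle (φ.symm : H →L[ℂ] F) (‖(φ.symm : H →L[ℂ] F)‖ + 1) (by positivity)
      (by linarith)
    rw [h1] at h2
    exact pos_of_mul_pos_right (one_pos.trans_le h2) (by positivity)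
  refine ⟨T, hT1, fun K c hc hK => natCast_le_mul_of_forall_one_add_pow_le hc fun t ht => ?_⟩
  let A : H →L[ℂ] H := ContinuousLinearMap.id ℂ H + (t : ℂ) • K.starProjection
  have hdA : d (T.comp A) = (1 + t) ^ finrank ℂ K * d T := by
    have hP : LinearMap.IsProj K (K.starProjection : H →ₗ[ℂ] H) :=
      ⟨fun x => K.starProjection_apply_mem x,
        fun x hx => Submodule.starProjection_eq_self_iff.2 hx⟩
    have hA : LinearMap.det (A : H →ₗ[ℂ] H) = (1 + (t : ℂ)) ^ finrank ℂ K :=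
      hP.det_one_add_smul t
    have ht1 : ‖(1 + (t : ℂ))‖ = 1 + t := by
      rw [← Complex.ofReal_one, ← Complex.ofReal_add, Complex.norm_real,
        Real.norm_of_nonneg (by positivity)]
    simp only [d, ContinuousLinearMap.det, ContinuousLinearMap.toLinearMap_comp,
      ← LinearMap.comp_assoc]
    rw [LinearMap.det_comp, hA, norm_mul, norm_pow, ht1, mul_comm]
  have hnorm : ‖T.comp A‖ ≤ 1 + t * c := by
    refine ContinuousLinearMap.opNorm_le_bound _ (by positivity) fun u => ?_
    have hTu : ‖T u‖ ≤ ‖u‖ := by simpa using T.le_of_opNorm_le hT1 u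
    have hPu : ‖T (K.starProjection u)‖ ≤ c * ‖u‖ :=
      (hK _ (K.starProjection_apply_mem u)).trans
        (mul_le_mul_of_nonneg_left (K.norm_starProjection_apply_le u) hc)
    calc ‖(T.comp A) u‖ = ‖T u + (t : ℂ) • T (K.starProjection u)‖ := by simp [A]
      _ ≤ ‖T u‖ + t * ‖T (K.starProjection u)‖ := by
        refine (norm_add_le _ _).trans_eq ?_
        rw [norm_smul, Complex.norm_real, Real.norm_of_nonneg ht]
      _ ≤ ‖u‖ + t * (c * ‖u‖) := by gcongr
      _ = (1 + t * c) * ‖u‖ := by ring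
  have h := hle _ (1 + t * c) (by positivity) hnorm
  rw [hdA] at h
  exact le_of_mul_le_mul_right h hpos

/-- An operator which is not small on large subspaces is large on an orthonormal system. -/
lemma exists_orthonormal_forall_le_norm (T : H →L[ℂ] F) {c : ℝ} {n : ℕ}
    (hT : ∀ K : Submodule ℂ H, (∀ u ∈ K, ‖T u‖ ≤ c * ‖u‖) → finrank ℂ K + n ≤ finrank ℂ H) :
    ∃ e : Fin n → H, Orthonormal ℂ e ∧ ∀ i, c ≤ ‖T (e i)‖ := by
  classical
  have key : ∀ k ≤ n, ∃ s : Finset H, s.card = k ∧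
      Orthonormal ℂ (Subtype.val : ↥(s : Set H) → H) ∧ ∀ u ∈ s, c ≤ ‖T u‖ := by
    intro k
    induction k with
    | zero => exact fun _ => ⟨∅, by simp⟩
    | succ k ih =>
      intro hk
      obtain ⟨s, hs, ho, hsc⟩ := ih (by omega)
      set K := Submodule.span ℂ (s : Set H)
      have hfin : finrank ℂ K ≤ k := hs ▸ finrank_span_finset_le_card (R := ℂ) s
      obtain ⟨u, huK, hu⟩ : ∃ u ∈ Kᗮ, c * ‖u‖ < ‖T u‖ := by
        by_contra! hcon
        have h1 := hT Kᗮ hcon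
        have h2 := K.finrank_add_finrank_orthogonal
        omega
      have hu0 : u ≠ 0 := by
        rintro rfl
        simp at hu
      have hun : 0 < ‖u‖ := norm_pos_iff.2 hu0
      set v : H := ((‖u‖⁻¹ : ℝ) : ℂ) • u
      have hv1 : ‖v‖ = 1 := by
        rw [norm_smul, Complex.norm_real, Real.norm_of_nonneg (by positivity)]
        exact inv_mul_cancel₀ hun.ne'
      have hvK : v ∈ Kᗮ := Kᗮ.smul_mem _ huK
      have hvs : ∀ w ∈ s, inner ℂ w v = 0 := fun w hw =>
        (K.mem_orthogonal v).1 hvK w (Submodule.subset_span hw)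
      have hvv : inner ℂ v v = (1 : ℂ) := by
        rw [inner_self_eq_norm_sq_to_K, hv1]
        simp
      have hvn : v ∉ s := fun hv => one_ne_zero (hvv.symm.trans (hvs v hv))
      refine ⟨insert v s, by rw [Finset.card_insert_of_notMem hvn, hs], ?_, ?_⟩
      · rw [orthonormal_subtype_iff_ite] at ho ⊢
        intro x hx y hy
        rw [Finset.mem_coe, Finset.mem_insert] at hx hy
        rcases hx with rfl | hx <;> rcases hy with rfl | hy
        · rw [if_pos rfl, hvv]
        · rw [if_neg (fun h : v = y => hvn (h ▸ hy)), inner_eq_zero_symm.1 (hvs y hy)]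
        · rw [if_neg (fun h : x = v => hvn (h ▸ hx)), hvs x hx]
        · exact ho x hx y hy
      · intro x hx
        rcases Finset.mem_insert.1 hx with rfl | hx
        · rw [map_smul, norm_smul, Complex.norm_real, Real.norm_of_nonneg (by positivity),
            inv_mul_eq_div, le_div_iff₀ hun]
          exact hu.le
        · exact hsc x hx
  obtain ⟨s, hs, ho, hsc⟩ := key n le_rfl
  let f := (s.equivFinOfCardEq hs).symm
  exact ⟨fun i => f i, ho.comp f f.injective, fun i => hsc _ (f i).2⟩

end DvoretzkyRogers

/-- A submodule of every finite dimension exists in an infinite-dimensional space. -/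
lemma exists_submodule_finrank_eq {V : Type*} [AddCommGroup V] [Module ℂ V]
    (hV : ¬ FiniteDimensional ℂ V) (N : ℕ) :
    ∃ F : Submodule ℂ V, FiniteDimensional ℂ F ∧ finrank ℂ F = N := by
  have hr : (N : Cardinal) ≤ Module.rank ℂ V := by
    refine le_trans (Cardinal.natCast_lt_aleph0).le ?_
    rwa [← not_lt, Module.rank_lt_aleph0_iff]
  obtain ⟨f, hf⟩ := exists_linearIndependent_of_le_rank hr
  exact ⟨Submodule.span ℂ (Set.range f), FiniteDimensional.span_of_finite ℂ (Set.finite_range f),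
    by simpa using finrank_span_eq_card hf⟩

/-- A weak form of the Dvoretzky-Rogers lemma: an infinite-dimensional space contains images of
orthonormal systems of any finite length under contractions, with norms as close to `1` as
desired. -/
lemma exists_contraction_orthonormal_forall_le_norm {E : Type*} [NormedAddCommGroup E]
    [NormedSpace ℂ E] (hE : ¬ FiniteDimensional ℂ E) {c : ℝ} (hc0 : 0 ≤ c) (hc1 : c < 1) (n : ℕ) :
    ∃ (N : ℕ) (T : EuclideanSpace ℂ (Fin N) →L[ℂ] E) (e : Fin n → EuclideanSpace ℂ (Fin N)),
      ‖T‖ ≤ 1 ∧ Orthonormal ℂ e ∧ ∀ i, c ≤ ‖T (e i)‖ := by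
  obtain ⟨N, hN⟩ := exists_nat_ge (n / (1 - c))
  rw [div_le_iff₀ (by linarith)] at hN
  obtain ⟨F, hF, hFN⟩ := exists_submodule_finrank_eq hE N
  obtain ⟨T, hT, hK⟩ := exists_contraction_forall_finrank_le
    (H := EuclideanSpace ℂ (Fin N)) (F := F) (by simp [hFN])
  obtain ⟨e, he, hce⟩ := exists_orthonormal_forall_le_norm T (c := c) (n := n) fun K h => by
    have h1 := hK K c hc0 h
    rw [finrank_euclideanSpace_fin] at h1 ⊢
    have : (finrank ℂ K + n : ℝ) ≤ N := by linarith
    exact_mod_cast this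
  refine ⟨N, F.subtypeL.comp T, e, ?_, he, hce⟩
  exact ContinuousLinearMap.opNorm_le_bound _ zero_le_one fun u => T.le_of_opNorm_le hT u

section WeakSumming

variable {E : Type*} [NormedAddCommGroup E] [NormedSpace ℂ E] {p q : ℝ} {n : ℕ}

lemma bddAbove_weakSummingNorm (hp : 0 < p) (x : Fin n → E) :
    BddAbove {s : ℝ | ∃ lam : E →L[ℂ] ℂ, ‖lam‖ ≤ 1 ∧
      s = (∑ i, ‖lam (x i)‖ ^ p) ^ (1 / p)} := by
  refine ⟨(∑ i, ‖x i‖ ^ p) ^ (1 / p), ?_⟩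
  rintro s ⟨lam, hlam, rfl⟩
  gcongr with i
  simpa using lam.le_of_opNorm_le hlam (x i)

lemma norm_le_weakSummingNorm (hp : 0 < p) (x : Fin n → E) (i : Fin n) :
    ‖x i‖ ≤ weakSummingNorm p x := by
  obtain ⟨g, hg, hgx⟩ := exists_dual_vector'' ℂ (x i)
  refine le_trans ?_ (le_csSup (bddAbove_weakSummingNorm hp x) ⟨g, hg, rfl⟩)
  have h1 : ‖x i‖ ^ p ≤ ∑ j, ‖g (x j)‖ ^ p := by
    have h := Finset.single_le_sum (f := fun j => ‖g (x j)‖ ^ p)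
      (fun j _ => by positivity) (Finset.mem_univ i)
    simpa [hgx] using h
  calc ‖x i‖ = (‖x i‖ ^ p) ^ (1 / p) := by
        rw [← Real.rpow_mul (norm_nonneg _), mul_one_div_cancel hp.ne', Real.rpow_one]
    _ ≤ _ := by gcongr

/-- The image of an orthonormal system under a contraction has weak `p`-summing norm at most one
for `p ≥ 2`. -/
lemma weakSummingNorm_comp_orthonormal_le_one {H : Type*} [NormedAddCommGroup H]
    [InnerProductSpace ℂ H] [CompleteSpace H] (hp : 2 ≤ p) {T : H →L[ℂ] E} (hT : ‖T‖ ≤ 1)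
    {e : Fin n → H} (he : Orthonormal ℂ e) : weakSummingNorm p (fun i => T (e i)) ≤ 1 := by
  refine csSup_le ⟨_, 0, by simp, rfl⟩ ?_
  rintro s ⟨lam, hlam, rfl⟩
  set y := (InnerProductSpace.toDual ℂ H).symm (lam.comp T) with hy
  have hy1 : ‖y‖ ≤ 1 := by
    rw [hy, LinearIsometryEquiv.norm_map]
    exact (lam.opNorm_comp_le T).trans (mul_le_one₀ hlam (norm_nonneg _) hT)
  have hin : ∀ i, ‖lam (T (e i))‖ = ‖inner ℂ (e i) y‖ := fun i => by
    rw [norm_inner_symm, hy, InnerProductSpace.toDual_symm_apply]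
    rfl
  have hle1 : ∀ i, ‖inner ℂ (e i) y‖ ≤ 1 := fun i =>
    (norm_inner_le_norm _ _).trans (by rw [he.1 i, one_mul]; exact hy1)
  refine Real.rpow_le_one (by positivity) ?_ (by positivity)
  calc ∑ i, ‖lam (T (e i))‖ ^ p ≤ ∑ i, ‖inner ℂ (e i) y‖ ^ 2 := by
        refine Finset.sum_le_sum fun i _ => ?_
        rw [hin, ← Real.rpow_natCast]
        exact Real.rpow_le_rpow_of_exponent_ge' (norm_nonneg _) (hle1 i) (by norm_num)
          (by exact_mod_cast hp)
    _ ≤ ‖y‖ ^ 2 := he.sum_inner_products_le y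
    _ ≤ 1 := pow_le_one₀ (norm_nonneg _) hy1

lemma sum_norm_rpow_le_of_weakSummingNorm_le_one (hp : 0 < p) (hq : 0 < q) {x : Fin n → E}
    (hx : weakSummingNorm p x ≤ 1) : (∑ i, ‖x i‖ ^ q) ^ (1 / q) ≤ (n : ℝ) ^ (1 / q) := by
  gcongr
  calc ∑ i, ‖x i‖ ^ q ≤ ∑ _i : Fin n, (1 : ℝ) := Finset.sum_le_sum fun i _ =>
        Real.rpow_le_one (norm_nonneg _) ((norm_le_weakSummingNorm hp x i).trans hx) hq.le
    _ = n := by simp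

end WeakSumming

theorem stmt5 (E : Type*) [NormedAddCommGroup E] [NormedSpace ℂ E]
    (hE : ¬ FiniteDimensional ℂ E)
    (p q : ℝ) (hp : 2 ≤ p) (hpq : p ≤ q) (n : ℕ) :
    summingConstant E q p n = (n : ℝ) ^ (1 / q) := by
  have hp0 : 0 < p := by linarith
  have hq0 : 0 < q := by linarith
  have hub : (n : ℝ) ^ (1 / q) ∈ upperBounds {s : ℝ | ∃ x : Fin n → E,
      weakSummingNorm p x ≤ 1 ∧ s = (∑ i, ‖x i‖ ^ q) ^ (1 / q)} := by
    rintro s ⟨x, hx, rfl⟩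
    exact sum_norm_rpow_le_of_weakSummingNorm_le_one hp0 hq0 hx
  have hlow : ∀ c : ℝ, 0 ≤ c → c < 1 → c * (n : ℝ) ^ (1 / q) ≤ summingConstant E q p n := by
    intro c hc0 hc1
    obtain ⟨N, T, e, hT, he, hce⟩ := exists_contraction_orthonormal_forall_le_norm hE hc0 hc1 n
    refine le_trans ?_ (le_csSup ⟨_, hub⟩
      ⟨fun i => T (e i), weakSummingNorm_comp_orthonormal_le_one hp hT he, rfl⟩)
    calc c * (n : ℝ) ^ (1 / q) = (∑ _i : Fin n, c ^ q) ^ (1 / q) := by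
          rw [Finset.sum_const, Finset.card_fin, nsmul_eq_mul,
            Real.mul_rpow (by positivity) (by positivity), ← Real.rpow_mul hc0,
            mul_one_div_cancel hq0.ne', Real.rpow_one, mul_comm]
      _ ≤ _ := by
          gcongr with i
          exact hce i
  refine le_antisymm (Real.sSup_le hub (by positivity)) ?_
  · have hlim : Filter.Tendsto (fun c : ℝ => c * (n : ℝ) ^ (1 / q)) (nhdsWithin 1 (Set.Iio 1))
        (nhds (1 * (n : ℝ) ^ (1 / q))) :=
      ((continuous_id.mul continuous_const).tendsto 1).mono_left nhdsWithin_le_nhds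
    rw [one_mul] at hlim
    refine le_of_tendsto hlim ?_
    filter_upwards [Ioo_mem_nhdsLT (zero_lt_one' ℝ)] with c hc
    exact hlow c hc.1.le hc.2
end

section
/- Let $H$ be a complex Hilbert space and let $y_1, y_2 \in H$ be such that $(y_1, y_2)$ is an extreme point of the set $L = \{(z_1,z_2) \in H^2 : \|\zeta_1 z_1 + \zeta_2 z_2\| \le 1 \text{ for all } \zeta_1, \zeta_2 \in \mathbb{T}\}$. If $\dim H \ge 2$, then $\langle y_1, y_2 \rangle = 0$. -/
open scoped ComplexInnerProductSpace

section

variable {H : Type*} [NormedAddCommGroup H] [InnerProductSpace ℂ H]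

/-- If `⟪a, b⟫` is a nonnegative real number, then `‖ζ₁ • a + ζ₂ • b‖` is largest over
unimodular `ζ₁, ζ₂` at `ζ₁ = ζ₂ = 1`. -/
lemma norm_unimodular_smul_add_le {a b : H} {s : ℝ} (hs : 0 ≤ s) (hab : ⟪a, b⟫ = (s : ℂ))
    {ζ₁ ζ₂ : ℂ} (h₁ : ‖ζ₁‖ = 1) (h₂ : ‖ζ₂‖ = 1) : ‖ζ₁ • a + ζ₂ • b‖ ≤ ‖a + b‖ := by
  refine (sq_le_sq₀ (norm_nonneg _) (norm_nonneg _)).mp ?_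
  rw [norm_add_sq (𝕜 := ℂ), norm_add_sq (𝕜 := ℂ) a b, norm_smul, norm_smul, h₁, h₂, hab]
  have h : RCLike.re ⟪ζ₁ • a, ζ₂ • b⟫ ≤ s := by
    refine (RCLike.re_le_norm _).trans ?_
    simp [h₁, h₂, hab, abs_of_nonneg hs]
  have h' : RCLike.re (s : ℂ) = s := Complex.ofReal_re s
  rw [h']
  linarith

/-- Moving `a` and `b` in opposite real multiples of `a + b` keeps a real inner product real. -/
lemma inner_add_smul_sub_smul {a b : H} {r : ℝ} (hab : ⟪a, b⟫ = (r : ℂ)) (t : ℝ) :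
    ⟪a + (t : ℂ) • (a + b), b - (t : ℂ) • (a + b)⟫ =
      ((r + t * (‖b‖ ^ 2 - ‖a‖ ^ 2) - t ^ 2 * (‖a‖ ^ 2 + 2 * r + ‖b‖ ^ 2) : ℝ) : ℂ) := by
  have hba : ⟪b, a⟫ = (r : ℂ) := by rw [← inner_conj_symm, hab, Complex.conj_ofReal]
  simp only [inner_add_left, inner_sub_right, inner_add_right, inner_smul_left, inner_smul_right,
    hab, hba, inner_self_eq_norm_sq_to_K, Complex.conj_ofReal]
  push_cast
  simp only [Complex.coe_algebraMap]
  ring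

lemma norm_unimodular_smul_perturb_le {a b : H} {r : ℝ} (hr : 0 ≤ r) (hab : ⟪a, b⟫ = (r : ℂ))
    (hp : ‖a + b‖ ≤ 1) {t : ℝ} (ht : |t| = r / 2) {ζ₁ ζ₂ : ℂ} (h₁ : ‖ζ₁‖ = 1) (h₂ : ‖ζ₂‖ = 1) :
    ‖ζ₁ • (a + (t : ℂ) • (a + b)) + ζ₂ • (b - (t : ℂ) • (a + b))‖ ≤ 1 := by
  have hP : ‖a‖ ^ 2 + 2 * r + ‖b‖ ^ 2 ≤ 1 := by
    have h := norm_add_sq (𝕜 := ℂ) a b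
    have h' : RCLike.re (r : ℂ) = r := Complex.ofReal_re r
    rw [hab, h'] at h
    rw [← h]
    exact pow_le_one₀ (norm_nonneg _) hp
  refine (norm_unimodular_smul_add_le ?_ (inner_add_smul_sub_smul hab t) h₁ h₂).trans ?_
  · have hD : |‖b‖ ^ 2 - ‖a‖ ^ 2| ≤ 1 := by
      rw [abs_le]
      constructor <;> nlinarith [sq_nonneg ‖a‖, sq_nonneg ‖b‖]
    have hlin : -(r / 2) ≤ t * (‖b‖ ^ 2 - ‖a‖ ^ 2) := by
      refine neg_le_of_abs_le ?_
      rw [abs_mul, ht]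
      exact mul_le_of_le_one_right (by linarith) hD
    have hquad : t ^ 2 * (‖a‖ ^ 2 + 2 * r + ‖b‖ ^ 2) ≤ r ^ 2 / 4 := by
      have : t ^ 2 = r ^ 2 / 4 := by rw [← sq_abs, ht]; ring
      rw [this]
      exact mul_le_of_le_one_right (by positivity) hP
    nlinarith [sq_nonneg ‖a‖, sq_nonneg ‖b‖]
  · rwa [add_add_sub_cancel]

end

theorem stmt14 {H : Type*} [NormedAddCommGroup H] [InnerProductSpace ℂ H]
    (hdim : 2 ≤ Module.rank ℂ H) (y₁ y₂ : H)
    (hext : (y₁, y₂) ∈ Set.extremePoints ℝ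
      {z : H × H | ∀ ζ₁ ζ₂ : ℂ, ‖ζ₁‖ = 1 → ‖ζ₂‖ = 1 → ‖ζ₁ • z.1 + ζ₂ • z.2‖ ≤ 1}) :
    ⟪y₁, y₂⟫ = 0 := by
  by_contra hc
  obtain ⟨hL, hext⟩ := hext
  set r : ℝ := ‖⟪y₁, y₂⟫‖ with hr
  have hr0 : 0 < r := norm_pos_iff.mpr hc
  obtain ⟨ω, hω, hωc⟩ : ∃ ω : ℂ, ‖ω‖ = 1 ∧ ω * ⟪y₁, y₂⟫ = r := by
    refine ⟨r / ⟪y₁, y₂⟫, ?_, div_mul_cancel₀ _ hc⟩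
    rw [norm_div, Complex.norm_real, Real.norm_of_nonneg hr0.le, ← hr, div_self hr0.ne']
  have hω0 : ω ≠ 0 := norm_ne_zero_iff.mp (by rw [hω]; exact one_ne_zero)
  have hin : ⟪y₁, ω • y₂⟫ = (r : ℂ) := by rw [inner_smul_right, hωc]
  have hp : ‖y₁ + ω • y₂‖ ≤ 1 := by simpa using hL 1 ω norm_one hω
  set p : H := y₁ + ω • y₂ with hpdef
  have hmem (t : ℝ) (ht : |t| = r / 2) :
      (y₁ + (t : ℂ) • p, y₂ - (ω⁻¹ * t) • p) ∈
        {z : H × H | ∀ ζ₁ ζ₂ : ℂ, ‖ζ₁‖ = 1 → ‖ζ₂‖ = 1 → ‖ζ₁ • z.1 + ζ₂ • z.2‖ ≤ 1} := by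
    intro ζ₁ ζ₂ h₁ h₂
    have h := norm_unimodular_smul_perturb_le hr0.le hin hp ht h₁
      (ζ₂ := ζ₂ * ω⁻¹) (by rw [norm_mul, norm_inv, h₂, hω]; simp)
    rw [← hpdef] at h
    convert h using 3
    rw [mul_smul ζ₂, smul_sub ω⁻¹, inv_smul_smul₀ hω0, smul_smul ω⁻¹]
  have hseg : (y₁, y₂) ∈ openSegment ℝ
      (y₁ + ((r / 2 : ℝ) : ℂ) • p, y₂ - (ω⁻¹ * ((r / 2 : ℝ) : ℂ)) • p)
      (y₁ + ((-(r / 2) : ℝ) : ℂ) • p, y₂ - (ω⁻¹ * ((-(r / 2) : ℝ) : ℂ)) • p) := by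
    refine ⟨1 / 2, 1 / 2, by norm_num, by norm_num, by norm_num, ?_⟩
    ext <;> simp only [Prod.smul_mk, Prod.mk_add_mk, Complex.ofReal_neg, mul_neg] <;> module
  have heq := hext (hmem (r / 2) (abs_of_pos (half_pos hr0)))
    (hmem (-(r / 2)) (by rw [abs_neg, abs_of_pos (half_pos hr0)])) hseg
  have hp0 : p = 0 := by
    have h := congrArg Prod.fst heq
    simp only [add_eq_left, smul_eq_zero, Complex.ofReal_eq_zero] at h
    exact h.resolve_left (half_pos hr0).ne'
  have h := norm_add_sq (𝕜 := ℂ) y₁ (ω • y₂)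
  have h' : RCLike.re (r : ℂ) = r := Complex.ofReal_re r
  rw [hin, h', ← hpdef, hp0, norm_zero] at h
  nlinarith [sq_nonneg ‖y₁‖, sq_nonneg ‖ω • y₂‖]
end
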